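/- If k ∈ {3,4} and G is a connected k-colorable graph of order n with minimum degree at least δ ≥ 1, then diam(G) ≤ (3 − 2/k)·(n/δ) − 1. -/

import Mathlib

/-- Layer `j` is pinched if both adjacent layers consist of one and the same colour `a`, and layer
`j` contains all other colours. -/
def Pinched {k : ℕ} (S : ℤ → Finset (Fin k)) (j : ℤ) : Prop :=
  ∃ a, S (j - 1) = {a} ∧ S (j + 1) = {a} ∧ ∀ c, c ≠ a → c ∈ S j

open Classical in
/-- The weight a pinched layer takes from each of its two neighbours. -/
noncomputable def surplus {k : ℕ} (S : ℤ → Finset (Fin k)) (j : ℤ) : ℝ :=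
  if Pinched S j then
    if Pinched S (j - 2) ∨ Pinched S (j + 2) then ((k : ℝ) - 2) / 4 else ((k : ℝ) - 2) / 2
  else 0

/-- The total dual weight of layer `j`. -/
noncomputable def layerWeight {k : ℕ} (S : ℤ → Finset (Fin k)) (j : ℤ) : ℝ :=
  (if (S j).Nonempty then (k : ℝ) else 0) + 2 * surplus S j - surplus S (j - 1) - surplus S (j + 1)

open Classical in
/-- A lower bound for the dual weight of colour `c` in layer `j`. -/
noncomputable def demand {k : ℕ} (S : ℤ → Finset (Fin k)) (j : ℤ) (c : Fin k) : ℝ :=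
  if Pinched S j then
    if c ∈ S (j + 1) then 0 else ((k : ℝ) + 2 * surplus S j) / ((k : ℝ) - 1)
  else if (S j).card + 1 < k then 2
  else if ∃ i, (i = j - 1 ∨ i = j + 1) ∧ (S i).card = k then
    if (S j).card = k then 1 else (k : ℝ) / ((k : ℝ) - 1)
  else if ∃ i, (i = j - 1 ∨ i = j + 1) ∧ (S i).card + 1 = k ∧ c ∈ S i then
    if (S j).card = k then ((k : ℝ) - 2) / ((k : ℝ) - 1) else 1
  else if (S (j - 1)).Nonempty ∧ (S (j + 1)).Nonempty ∧ c ∉ S (j - 1) ∧ c ∉ S (j + 1) then 2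
  else 0

section Weights

variable {k : ℕ} {S : ℤ → Finset (Fin k)} {i j : ℤ} {c : Fin k}

lemma Pinched.card_pred (h : Pinched S j) : (S (j - 1)).card = 1 := by
  obtain ⟨a, h, -, -⟩ := h
  simp [h]

lemma Pinched.card_succ (h : Pinched S j) : (S (j + 1)).card = 1 := by
  obtain ⟨a, -, h, -⟩ := h
  simp [h]

lemma Pinched.le_card (h : Pinched S j) : k ≤ (S j).card + 1 := by
  obtain ⟨a, -, -, h⟩ := h
  have : (Finset.univ.erase a) ⊆ S j := fun c hc => h c (Finset.ne_of_mem_erase hc)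
  have := Finset.card_le_card this
  rw [Finset.card_erase_of_mem (Finset.mem_univ a), Finset.card_fin] at this
  omega

lemma Pinched.card_nbr (h : Pinched S j) (hi : i = j - 1 ∨ i = j + 1) : (S i).card = 1 := by
  rcases hi with rfl | rfl
  exacts [h.card_pred, h.card_succ]

lemma surplus_nonneg (hk : 2 ≤ k) : 0 ≤ surplus S j := by
  have : (2 : ℝ) ≤ k := by exact_mod_cast hk
  unfold surplus
  split_ifs <;> linarith

lemma surplus_le (hk : 2 ≤ k) : surplus S j ≤ ((k : ℝ) - 2) / 2 := by
  have : (2 : ℝ) ≤ k := by exact_mod_cast hk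
  unfold surplus
  split_ifs <;> linarith

lemma surplus_eq_zero (h : ¬ Pinched S j) : surplus S j = 0 := if_neg h

lemma surplus_add_le (hk : 2 ≤ k) :
    surplus S (j - 1) + surplus S (j + 1) ≤ ((k : ℝ) - 2) / 2 := by
  have : (2 : ℝ) ≤ k := by exact_mod_cast hk
  have e1 : j - 1 + 2 = j + 1 := by ring
  have e2 : j + 1 - 2 = j - 1 := by ring
  unfold surplus
  rw [e1, e2]
  split_ifs <;> first | linarith | tauto

lemma not_pinched_nbr (h : (S j).card ≠ 1) (hi : i = j - 1 ∨ i = j + 1) : ¬ Pinched S i :=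
  fun hp => h (hp.card_nbr (by omega))

lemma layerWeight_of_card_ne_one (h : (S j).card ≠ 1) (hne : (S j).Nonempty) :
    layerWeight S j = k + 2 * surplus S j := by
  simp [layerWeight, hne, surplus_eq_zero (not_pinched_nbr h (Or.inl rfl)),
    surplus_eq_zero (not_pinched_nbr h (Or.inr rfl))]

lemma layerWeight_le (hk : 2 ≤ k) : layerWeight S j ≤ k + 2 * surplus S j := by
  have h1 := surplus_nonneg (S := S) (j := j - 1) hk
  have h2 := surplus_nonneg (S := S) (j := j + 1) hk
  have : (0 : ℝ) ≤ k := by positivity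
  unfold layerWeight
  split_ifs <;> linarith

lemma layerWeight_le_of_not_pinched (hk : 2 ≤ k) (h : ¬ Pinched S j) : layerWeight S j ≤ k := by
  simpa [surplus_eq_zero h] using layerWeight_le (S := S) (j := j) hk

lemma layerWeight_nonpos (hk : 2 ≤ k) (h : S j = ∅) : layerWeight S j ≤ 0 := by
  have h1 := surplus_nonneg (S := S) (j := j - 1) hk
  have h2 := surplus_nonneg (S := S) (j := j + 1) hk
  have h3 : ¬ Pinched S j := fun hp => by
    have := hp.le_card
    rw [h, Finset.card_empty] at this
    omega
  simp [layerWeight, h, surplus_eq_zero h3]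
  linarith

lemma demand_nonneg (hk : 2 ≤ k) : 0 ≤ demand S j c := by
  have : (2 : ℝ) ≤ k := by exact_mod_cast hk
  have h1 := surplus_nonneg (S := S) (j := j) hk
  unfold demand
  split_ifs <;> first | positivity | (apply div_nonneg <;> linarith)

/-- Colours of a layer that is not pinched and is missed by both neighbours are few. -/
lemma card_sdiff_union_le (hp : ¬ Pinched S j) (h1 : (S (j - 1)).Nonempty)
    (h2 : (S (j + 1)).Nonempty) : (S j \ (S (j - 1) ∪ S (j + 1))).card + 2 ≤ k := by
  by_contra! hlt
  set U := S j \ (S (j - 1) ∪ S (j + 1)) with hU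
  have hc : Uᶜ.card ≤ 1 := by
    rw [Finset.card_compl, Fintype.card_fin]; omega
  rw [Finset.card_le_one] at hc
  have hm1 : ∀ x ∈ S (j - 1), x ∈ Uᶜ := fun x hx => by simp [hU, hx]
  have hm2 : ∀ x ∈ S (j + 1), x ∈ Uᶜ := fun x hx => by simp [hU, hx]
  obtain ⟨a, ha⟩ := h1
  obtain ⟨b, hb⟩ := h2
  refine hp ⟨a, ?_, ?_, fun c hca => ?_⟩
  · exact Finset.eq_singleton_iff_unique_mem.2 ⟨ha, fun x hx => hc _ (hm1 x hx) _ (hm1 a ha)⟩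
  · have hab : a = b := hc _ (hm1 a ha) _ (hm2 b hb)
    exact Finset.eq_singleton_iff_unique_mem.2
      ⟨hab ▸ hb, fun x hx => hc _ (hm2 x hx) _ (hm1 a ha)⟩
  · by_contra hcS
    exact hca (hc _ (by simp [hU, hcS]) _ (hm1 a ha))

lemma sum_demand_le (hk : k = 3 ∨ k = 4) (hne : (S j).Nonempty) :
    ∑ c ∈ S j, demand S j c ≤ layerWeight S j := by
  have hk2 : 2 ≤ k := by omega
  have hkR : (k : ℝ) = 3 ∨ (k : ℝ) = 4 := by exact_mod_cast hk
  have hk1 : (0 : ℝ) < k - 1 := by rcases hkR with h | h <;> rw [h] <;> norm_num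
  have hle : (S j).card ≤ k := by simpa using Finset.card_le_univ (S j)
  have hpos := hne.card_pos
  by_cases hp : Pinched S j
  · have hcard := hp.le_card
    rw [layerWeight_of_card_ne_one (by omega) hne]
    simp only [demand, if_pos hp]
    rw [Finset.sum_ite, Finset.sum_const_zero, zero_add, Finset.sum_const, nsmul_eq_mul]
    obtain ⟨a, -, h2, -⟩ := id hp
    have hsub : (S j).filter (fun c => c ∉ S (j + 1)) ⊆ Finset.univ.erase a := by
      intro c; simp [h2]
    have := Finset.card_le_card hsub
    rw [Finset.card_erase_of_mem (Finset.mem_univ a), Finset.card_fin] at this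
    have h' : (((S j).filter (fun c => c ∉ S (j + 1))).card : ℝ) ≤ k - 1 := by
      rw [le_sub_iff_add_le]; exact_mod_cast (by omega)
    have hs := surplus_nonneg (S := S) (j := j) hk2
    rw [mul_div_assoc', div_le_iff₀ hk1, mul_comm]
    gcongr
  by_cases hsmall : (S j).card + 1 < k
  · simp only [demand, if_neg hp, if_pos hsmall, Finset.sum_const, nsmul_eq_mul]
    by_cases h1 : (S j).card = 1
    · have := surplus_add_le (S := S) (j := j) hk2
      simp only [h1, layerWeight, if_pos hne, surplus_eq_zero hp]
      rcases hkR with h | h <;> rw [h] at this ⊢ <;> push_cast <;> linarith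
    · rw [layerWeight_of_card_ne_one h1 hne, surplus_eq_zero hp]
      have h4 : (S j).card = 2 ∧ k = 4 := by omega
      rw [h4.1, h4.2]; norm_num
  rw [layerWeight_of_card_ne_one (by omega) hne, surplus_eq_zero hp, mul_zero, add_zero]
  by_cases hfull : ∃ i, (i = j - 1 ∨ i = j + 1) ∧ (S i).card = k
  · simp only [demand, if_neg hp, if_neg hsmall, if_pos hfull, Finset.sum_const, nsmul_eq_mul]
    split_ifs with h
    · simp [h]
    · have : ((S j).card : ℝ) = k - 1 := by
        rw [eq_sub_iff_add_eq]; exact_mod_cast (by omega)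
      rw [this]; field_simp; rfl
  by_cases hbig : ∃ i, (i = j - 1 ∨ i = j + 1) ∧ (S i).card + 1 = k
  · obtain ⟨i, hi, hik⟩ := hbig
    have hin : ∀ c ∈ S j ∩ S i, demand S j c =
        if (S j).card = k then ((k : ℝ) - 2) / ((k : ℝ) - 1) else 1 := by
      intro c hc
      have : ∃ i, (i = j - 1 ∨ i = j + 1) ∧ (S i).card + 1 = k ∧ c ∈ S i :=
        ⟨i, hi, hik, (Finset.mem_inter.1 hc).2⟩
      simp only [demand, if_neg hp, if_neg hsmall, if_neg hfull, if_pos this]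
    have hout : ∀ c ∈ S j \ S i, demand S j c ≤ 2 := by
      intro c hc
      simp only [demand, if_neg hp, if_neg hsmall, if_neg hfull]
      split_ifs <;> first
        | (rw [div_le_iff₀ hk1]; linarith)
        | norm_num
    have hsplit := Finset.sum_inter_add_sum_sdiff (S j) (S i) (demand S j)
    rw [Finset.sum_congr rfl hin, Finset.sum_const, nsmul_eq_mul] at hsplit
    have hsum := Finset.sum_le_card_nsmul _ _ _ hout
    rw [nsmul_eq_mul] at hsum
    have hcard := Finset.card_inter_add_card_sdiff (S j) (S i)
    have h1 : (S j \ S i).card ≤ 1 := by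
      have : S j \ S i ⊆ (S i)ᶜ := fun c hc => by
        simpa using (Finset.mem_sdiff.1 hc).2
      have := Finset.card_le_card this
      rw [Finset.card_compl, Fintype.card_fin] at this
      omega
    have h2 := Finset.card_le_card (Finset.inter_subset_right (s₁ := S j) (s₂ := S i))
    by_cases hjk : (S j).card = k
    · have h3 : (S j \ S i).card = 1 := by omega
      have h4 : (((S j ∩ S i).card : ℕ) : ℝ) = k - 1 := by
        rw [eq_sub_iff_add_eq]; exact_mod_cast (by omega)
      rw [if_pos hjk, h4, mul_div_cancel₀ _ hk1.ne'] at hsplit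
      rw [h3] at hsum
      push_cast at hsum
      linarith
    · have h3 : (S j ∩ S i).card + 2 * (S j \ S i).card ≤ k := by omega
      have h4 : ((S j ∩ S i).card : ℝ) + 2 * (S j \ S i).card ≤ k := by exact_mod_cast h3
      rw [if_neg hjk] at hsplit
      linarith
  · have hv : ∀ c ∈ S j, demand S j c = if (S (j - 1)).Nonempty ∧ (S (j + 1)).Nonempty ∧
        c ∉ S (j - 1) ∧ c ∉ S (j + 1) then 2 else 0 := by
      intro c hc
      have : ¬ ∃ i, (i = j - 1 ∨ i = j + 1) ∧ (S i).card + 1 = k ∧ c ∈ S i :=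
        fun ⟨i, h1, h2, _⟩ => hbig ⟨i, h1, h2⟩
      simp only [demand, if_neg hp, if_neg hsmall, if_neg hfull, if_neg this]
    rw [Finset.sum_congr rfl hv]
    by_cases hn : (S (j - 1)).Nonempty ∧ (S (j + 1)).Nonempty
    · have hU := card_sdiff_union_le hp hn.1 hn.2
      simp only [hn, true_and]
      rw [← Finset.sum_filter, Finset.sum_const, nsmul_eq_mul]
      have he : (S j).filter (fun c => c ∉ S (j - 1) ∧ c ∉ S (j + 1)) =
          S j \ (S (j - 1) ∪ S (j + 1)) := by
        ext c; simp
      rw [he]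
      have : (S j \ (S (j - 1) ∪ S (j + 1))).card * 2 ≤ k := by omega
      exact_mod_cast this
    · rw [Finset.sum_eq_zero]
      · positivity
      · intro c _
        rw [if_neg]; tauto

/-- Nonnegative lower bounds on a nonempty finset extend to weights with a larger prescribed sum. -/
lemma exists_weights_of_sum_le {α : Type*} [DecidableEq α] {s : Finset α} (hs : s.Nonempty)
    {p : α → ℝ} (hp : ∀ a, 0 ≤ p a) {w : ℝ} (hw : ∑ a ∈ s, p a ≤ w) :
    ∃ y : α → ℝ, (∀ a, 0 ≤ y a) ∧ (∀ a ∉ s, y a = 0) ∧ ∑ a ∈ s, y a = w ∧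
      ∀ a ∈ s, p a ≤ y a := by
  obtain ⟨b, hb⟩ := hs
  have hd : 0 ≤ w - ∑ a ∈ s, p a := by linarith
  refine ⟨fun a => if a ∈ s then p a + if a = b then w - ∑ a ∈ s, p a else 0 else 0,
    fun a => ?_, fun a ha => by simp [ha], ?_, fun a ha => ?_⟩
  · have := hp a
    dsimp only
    split_ifs <;> linarith
  · rw [Finset.sum_congr rfl (fun a ha => if_pos ha), Finset.sum_add_distrib]
    simp [hb]
  · simp only [ha, if_true]
    split_ifs <;> linarith

lemma two_le_of_demand_le (hk : k = 3 ∨ k = 4) {y : ℤ → Fin k → ℝ} (hy : ∀ j c, 0 ≤ y j c)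
    (hd : ∀ j, ∀ c ∈ S j, demand S j c ≤ y j c) (hc : c ∈ S j) (hp : ¬ Pinched S j)
    (h1 : (S (j - 1)).Nonempty) (h2 : (S (j + 1)).Nonempty) (hj : (S j).card ≠ 1) :
    2 ≤ y (j - 1) c + y j c + y (j + 1) c := by
  have hkR : (k : ℝ) = 3 ∨ (k : ℝ) = 4 := by exact_mod_cast hk
  have hle : ∀ i, (S i).card ≤ k := fun i => by simpa using Finset.card_le_univ (S i)
  -- It suffices to find enough weight in the layer and one neighbour.
  have key : ∀ i, (i = j - 1 ∨ i = j + 1) → 2 ≤ y j c + y i c →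
      2 ≤ y (j - 1) c + y j c + y (j + 1) c := by
    rintro i (rfl | rfl) h
    · linarith [hy (j + 1) c]
    · linarith [hy (j - 1) c]
  have hself : 2 ≤ demand S j c → 2 ≤ y (j - 1) c + y j c + y (j + 1) c := fun h => by
    linarith [hd j c hc, hy (j + 1) c, hy (j - 1) c]
  have hnp : ∀ i, (i = j - 1 ∨ i = j + 1) → ¬ Pinched S i := fun i hi => not_pinched_nbr hj hi
  by_cases hsmall : (S j).card + 1 < k
  · exact hself (by simp [demand, hp, hsmall])
  by_cases hfull : ∃ i, (i = j - 1 ∨ i = j + 1) ∧ (S i).card = k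
  · obtain ⟨i, hi, hik⟩ := id hfull
    have hci : c ∈ S i := by
      rw [(Finset.card_eq_iff_eq_univ (S i)).1 (by simpa using hik)]
      exact Finset.mem_univ c
    refine key i hi ?_
    have hdj := hd j c hc
    have hdi := hd i c hci
    have hismall : ¬ (S i).card + 1 < k := by omega
    simp only [demand, if_neg hp, if_neg hsmall, if_pos hfull] at hdj
    simp only [demand, if_neg (hnp i hi), if_neg hismall, if_pos hik] at hdi
    by_cases hjk : (S j).card = k
    · rw [if_pos ⟨j, by omega, hjk⟩] at hdi
      rw [if_pos hjk] at hdj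
      linarith
    · rw [if_neg hjk] at hdj
      have hex : ∃ l, (l = i - 1 ∨ l = i + 1) ∧ (S l).card + 1 = k ∧ c ∈ S l :=
        ⟨j, by omega, by have := hle j; omega, hc⟩
      rw [if_pos hex] at hdi
      split_ifs at hdi <;> rcases hkR with h | h <;> simp only [h] at hdi hdj <;>
        norm_num at hdi hdj <;> linarith
  by_cases hbig : ∃ i, (i = j - 1 ∨ i = j + 1) ∧ (S i).card + 1 = k ∧ c ∈ S i
  · obtain ⟨i, hi, hik, hci⟩ := id hbig
    refine key i hi ?_
    have hdj := hd j c hc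
    have hdi := hd i c hci
    have hismall : ¬ (S i).card + 1 < k := by omega
    have hik' : ¬ (S i).card = k := by omega
    simp only [demand, if_neg hp, if_neg hsmall, if_neg hfull, if_pos hbig] at hdj
    simp only [demand, if_neg (hnp i hi), if_neg hismall, if_neg hik'] at hdi
    by_cases hjk : (S j).card = k
    · rw [if_pos ⟨j, by omega, hjk⟩] at hdi
      rw [if_pos hjk] at hdj
      rcases hkR with h | h <;> rw [h] at hdi hdj <;> norm_num at hdi hdj <;> linarith
    · rw [if_neg hjk] at hdj
      have hex : ∃ l, (l = i - 1 ∨ l = i + 1) ∧ (S l).card + 1 = k ∧ c ∈ S l :=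
        ⟨j, by omega, by have := hle j; omega, hc⟩
      rw [if_pos hex] at hdi
      split_ifs at hdi
      · rcases hkR with h | h <;> rw [h] at hdi <;> norm_num at hdi <;> linarith
      · linarith
  by_cases hsh : ∃ i, (i = j - 1 ∨ i = j + 1) ∧ c ∈ S i
  · obtain ⟨i, hi, hci⟩ := hsh
    refine key i hi ?_
    have hismall : (S i).card + 1 < k := by
      have h4 : ¬ (S i).card = k := fun h => hfull ⟨i, hi, h⟩
      have h5 : ¬ (S i).card + 1 = k := fun h => hbig ⟨i, hi, h, hci⟩
      have := hle i
      omega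
    have hdi := hd i c hci
    simp only [demand, if_neg (hnp i hi), if_pos hismall] at hdi
    linarith [hy j c]
  · have hc1 : c ∉ S (j - 1) := fun h => hsh ⟨_, Or.inl rfl, h⟩
    have hc2 : c ∉ S (j + 1) := fun h => hsh ⟨_, Or.inr rfl, h⟩
    refine hself ?_
    simp only [demand, if_neg hp, if_neg hsmall, if_neg hfull, if_neg hbig]
    rw [if_pos ⟨h1, h2, hc1, hc2⟩]

lemma sum_layerWeight_sub_le (hk : k = 3 ∨ k = 4) {y : ℤ → Fin k → ℝ} (hy : ∀ j c, 0 ≤ y j c)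
    (hsum : ∀ j, (S j).Nonempty → ∑ c ∈ S j, y j c = layerWeight S j)
    (hd : ∀ j, ∀ c ∈ S j, demand S j c ≤ y j c) (hc : c ∈ S j) :
    (layerWeight S (j - 1) - y (j - 1) c) + (layerWeight S j - y j c) +
      (layerWeight S (j + 1) - y (j + 1) c) ≤ 3 * k - 2 := by
  have hk2 : 2 ≤ k := by omega
  have hkR : (k : ℝ) = 3 ∨ (k : ℝ) = 4 := by exact_mod_cast hk
  have hsingle : ∀ i, c ∈ S i → (S i).card = 1 → y i c = layerWeight S i := by
    intro i hci h1
    obtain ⟨a, ha⟩ := Finset.card_eq_one.1 h1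
    have hca : c = a := by simpa [ha] using hci
    rw [← hsum i ⟨c, hci⟩, ha, Finset.sum_singleton, hca]
  have hym := hy (j - 1) c
  have hyp := hy (j + 1) c
  have hyj := hy j c
  have hne : (S j).Nonempty := ⟨c, hc⟩
  have hpos := hne.card_pos
  by_cases h1 : (S j).card = 1
  · have h2 := hsingle j hc h1
    have h3 := layerWeight_le (S := S) (j := j - 1) hk2
    have h4 := layerWeight_le (S := S) (j := j + 1) hk2
    have h5 := surplus_add_le (S := S) (j := j) hk2
    linarith
  have hWj := layerWeight_of_card_ne_one h1 hne
  by_cases hp : Pinched S j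
  · have hdj := hd j c hc
    have hs := surplus_le (S := S) (j := j) hk2
    by_cases hcs : c ∈ S (j + 1)
    · have hcs' : c ∈ S (j - 1) := by
        obtain ⟨a, ha, hb, -⟩ := hp
        rw [ha, ← hb]; exact hcs
      have e1 := hsingle _ hcs hp.card_succ
      have e2 := hsingle _ hcs' hp.card_pred
      rw [e1, e2, hWj]
      rcases hkR with h | h <;> rw [h] at hs ⊢ <;> linarith
    · simp only [demand, if_pos hp, if_neg hcs] at hdj
      have hm : ¬ Pinched S (j - 1) := not_pinched_nbr h1 (Or.inl rfl)
      have hpl : ¬ Pinched S (j + 1) := not_pinched_nbr h1 (Or.inr rfl)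
      have n1 : (S (j - 1)).Nonempty := Finset.card_pos.1 (by rw [hp.card_pred]; norm_num)
      have n2 : (S (j + 1)).Nonempty := Finset.card_pos.1 (by rw [hp.card_succ]; norm_num)
      have e1 : j - 1 - 1 = j - 2 := by ring
      have e2 : j + 1 + 1 = j + 2 := by ring
      have w1 : layerWeight S (j - 1) = k - surplus S (j - 2) - surplus S j := by
        simp [layerWeight, n1, surplus_eq_zero hm, e1]
      have w2 : layerWeight S (j + 1) = k - surplus S j - surplus S (j + 2) := by
        simp [layerWeight, n2, surplus_eq_zero hpl, e2]
      have s1 := surplus_nonneg (S := S) (j := j - 2) hk2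
      have s2 := surplus_nonneg (S := S) (j := j + 2) hk2
      rw [w1, w2, hWj]
      by_cases hiso : Pinched S (j - 2) ∨ Pinched S (j + 2)
      · have hsj : surplus S j = ((k : ℝ) - 2) / 4 := by simp [surplus, hp, hiso]
        have hother : ((k : ℝ) - 2) / 4 ≤ surplus S (j - 2) + surplus S (j + 2) := by
          rcases hiso with h | h
          · have : surplus S (j - 2) = ((k : ℝ) - 2) / 4 := by simp [surplus, hp, h]
            linarith
          · have : surplus S (j + 2) = ((k : ℝ) - 2) / 4 := by simp [surplus, hp, h]
            linarith
        rw [hsj] at hdj ⊢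
        rcases hkR with h | h <;> rw [h] at hdj hother ⊢ <;> norm_num at hdj hother ⊢ <;> linarith
      · have hsj : surplus S j = ((k : ℝ) - 2) / 2 := by simp [surplus, hp, hiso]
        rw [hsj] at hdj ⊢
        rcases hkR with h | h <;> rw [h] at hdj ⊢ <;> norm_num at hdj ⊢ <;> linarith
  rw [surplus_eq_zero hp, mul_zero, add_zero] at hWj
  have w1 := layerWeight_le_of_not_pinched hk2 (not_pinched_nbr (S := S) h1 (Or.inl rfl))
  have w2 := layerWeight_le_of_not_pinched hk2 (not_pinched_nbr (S := S) h1 (Or.inr rfl))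
  have hk2R : (2 : ℝ) ≤ k := by exact_mod_cast hk2
  rcases (S (j - 1)).eq_empty_or_nonempty with he | n1
  · have := layerWeight_nonpos hk2 he
    linarith
  rcases (S (j + 1)).eq_empty_or_nonempty with he | n2
  · have := layerWeight_nonpos hk2 he
    linarith
  have := two_le_of_demand_le hk hy hd hc hp n1 n2 h1
  linarith

/-- A dual solution: weights on the colour classes of a layering of total `k` per layer, such that
the classes that may be adjacent to a given class have total weight at most `3 * k - 2`. -/
lemma exists_dual_weights (hk : k = 3 ∨ k = 4) (D : ℕ)
    (hS : ∀ j, (S j).Nonempty ↔ j ∈ Finset.Icc (0 : ℤ) D) :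
    ∃ y : ℤ → Fin k → ℝ, (∀ j c, 0 ≤ y j c) ∧ (∀ j, ∀ c ∉ S j, y j c = 0) ∧
      ∑ j ∈ Finset.Icc (0 : ℤ) D, ∑ c, y j c = k * (D + 1) ∧
      ∀ j, ∀ c ∈ S j, ∑ i ∈ Finset.Icc (j - 1) (j + 1), ∑ b ∈ Finset.univ.erase c, y i b
        ≤ 3 * k - 2 := by
  have hk2 : 2 ≤ k := by omega
  have hex : ∀ j, ∃ z : Fin k → ℝ, (∀ a, 0 ≤ z a) ∧ (∀ a ∉ S j, z a = 0) ∧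
      ((S j).Nonempty → ∑ a ∈ S j, z a = layerWeight S j) ∧ ∀ a ∈ S j, demand S j a ≤ z a := by
    intro j
    rcases (S j).eq_empty_or_nonempty with he | hne
    · exact ⟨0, by simp [he]⟩
    · obtain ⟨z, h1, h2, h3, h4⟩ := exists_weights_of_sum_le hne
        (fun a => demand_nonneg (S := S) (j := j) (c := a) hk2) (sum_demand_le hk hne)
      exact ⟨z, h1, h2, fun _ => h3, h4⟩
  choose y hy0 hyS hysum hyd using hex
  have hpin : ∀ j, Pinched S j → j ∈ Finset.Icc (1 : ℤ) (D - 1) := by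
    intro j hp
    have n1 := (hS (j - 1)).1 (Finset.card_pos.1 (by rw [hp.card_pred]; norm_num))
    have n2 := (hS (j + 1)).1 (Finset.card_pos.1 (by rw [hp.card_succ]; norm_num))
    rw [Finset.mem_Icc] at *
    omega
  have hfull : ∀ j, ∑ c, y j c = ∑ c ∈ S j, y j c := fun j =>
    (Finset.sum_subset (Finset.subset_univ _) fun c _ hc => hyS j c hc).symm
  have hle : ∀ j, ∑ c, y j c = layerWeight S j := by
    intro j
    rcases (S j).eq_empty_or_nonempty with he | hne
    · have hj : j ∉ Finset.Icc (0 : ℤ) D := by rw [← hS, he]; simp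
      rw [Finset.mem_Icc] at hj
      have h0 : ∀ i, i = j - 1 ∨ i = j ∨ i = j + 1 → surplus S i = 0 := by
        intro i hi
        refine surplus_eq_zero fun hp => ?_
        have := Finset.mem_Icc.1 (hpin i hp)
        omega
      rw [hfull, he, layerWeight, he, h0 (j - 1) (by simp), h0 j (by simp), h0 (j + 1) (by simp)]
      simp
    · rw [hfull, hysum j hne]
  refine ⟨y, hy0, hyS, ?_, fun j c hc => ?_⟩
  · have hrange : ∀ f : ℤ → ℝ, ∑ j ∈ Finset.Icc (0 : ℤ) D, f j =
        ∑ n ∈ Finset.range (D + 1), f n := by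
      intro f
      refine (Finset.sum_nbij (fun n : ℕ => (n : ℤ)) ?_ ?_ ?_ fun _ _ => rfl).symm
      · intro n hn
        simp only [Finset.mem_range, Finset.mem_Icc] at hn ⊢
        omega
      · exact fun a _ b _ h => by simpa using h
      · intro m hm
        simp only [Finset.coe_Icc, Set.mem_Icc] at hm
        exact ⟨m.toNat, by simp only [Finset.coe_range, Set.mem_Iio]; omega, by simp; omega⟩
    have htel : ∀ m : ℕ, ∑ n ∈ Finset.range m, (2 * surplus S n - surplus S ((n : ℤ) - 1) -
        surplus S ((n : ℤ) + 1)) = surplus S 0 - surplus S (-1) + surplus S ((m : ℤ) - 1) -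
          surplus S m := by
      intro m
      induction m with
      | zero => simp
      | succ m ih =>
        rw [Finset.sum_range_succ, ih]
        push_cast
        rw [add_sub_cancel_right]
        ring
    have hz : ∀ i, i ∉ Finset.Icc (1 : ℤ) (D - 1) → surplus S i = 0 := fun i hi =>
      surplus_eq_zero fun hp => hi (hpin i hp)
    have hw : ∀ n ∈ Finset.range (D + 1), ∑ c, y n c = k + (2 * surplus S n -
        surplus S ((n : ℤ) - 1) - surplus S ((n : ℤ) + 1)) := by
      intro n hn
      have hn' : (S n).Nonempty := (hS n).2 (by
        simp only [Finset.mem_range, Finset.mem_Icc] at hn ⊢; omega)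
      rw [hle, layerWeight, if_pos hn']
      ring
    rw [hrange, Finset.sum_congr rfl hw, Finset.sum_add_distrib, htel, hz 0 (by simp),
      hz (-1) (by simp), hz _ (by simp), hz _ (by simp)]
    simp
    ring
  · have hI : Finset.Icc (j - 1) (j + 1) = {j - 1, j, j + 1} := by
      ext i; simp only [Finset.mem_Icc, Finset.mem_insert, Finset.mem_singleton]; omega
    have hE : ∀ i, ∑ b ∈ Finset.univ.erase c, y i b = layerWeight S i - y i c := fun i => by
      rw [Finset.sum_erase_eq_sub (Finset.mem_univ c), hle]
    rw [hI, Finset.sum_insert (by simp; omega), Finset.sum_insert (by simp),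
      Finset.sum_singleton, hE, hE, hE, ← add_assoc]
    exact sum_layerWeight_sub_le hk hy0 hysum hyd hc

end Weights

/-- In a connected graph, every distance up to `G.dist u v` is attained from `u`. -/
lemma SimpleGraph.Connected.exists_dist_eq {V : Type*} {G : SimpleGraph V} (hG : G.Connected)
    (u v : V) {i : ℕ} (hi : i ≤ G.dist u v) : ∃ w, G.dist u w = i := by
  obtain ⟨p, hp⟩ := hG.exists_walk_length_eq_dist u v
  refine ⟨p.getVert i, le_antisymm ?_ ?_⟩
  · exact (SimpleGraph.dist_le (p.take i)).trans (by simp)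
  · have h1 := SimpleGraph.dist_le (p.drop i)
    have h2 := hG.dist_triangle (u := u) (v := p.getVert i) (w := v)
    rw [SimpleGraph.Walk.drop_length] at h1
    omega

/-- Weighted double counting of degrees over representatives of the classes of a vertex
partition. -/
lemma SimpleGraph.mul_sum_le_mul_card {V ι : Type*} [Fintype V] (G : SimpleGraph V)
    [DecidableRel G.Adj] {δ : ℕ} (hdeg : δ ≤ G.minDegree) (I : Finset ι) (r : ι → V)
    (y : ι → ℝ) (hy : ∀ i, 0 ≤ y i) {M : ℝ}
    (hM : ∀ u, ∑ i ∈ I with G.Adj u (r i), y i ≤ M) :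
    δ * ∑ i ∈ I, y i ≤ M * Fintype.card V := by
  calc δ * ∑ i ∈ I, y i = ∑ i ∈ I, δ * y i := Finset.mul_sum _ _ _
    _ ≤ ∑ i ∈ I, ∑ u : V, if G.Adj u (r i) then y i else 0 := by
      refine Finset.sum_le_sum fun i _ => ?_
      have hcard : (Finset.univ.filter fun u => G.Adj u (r i)).card = G.degree (r i) := by
        rw [← G.card_neighborFinset_eq_degree]
        congr 1
        ext u
        simp [G.adj_comm]
      rw [← Finset.sum_filter, Finset.sum_const, nsmul_eq_mul, hcard]
      have : (δ : ℝ) ≤ G.degree (r i) := by exact_mod_cast hdeg.trans (G.minDegree_le_degree _)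
      exact mul_le_mul_of_nonneg_right this (hy i)
    _ = ∑ u : V, ∑ i ∈ I with G.Adj u (r i), y i := by
      rw [Finset.sum_comm]
      exact Finset.sum_congr rfl fun u _ => (Finset.sum_filter _ _).symm
    _ ≤ ∑ _u : V, M := Finset.sum_le_sum fun u _ => hM u
    _ = M * Fintype.card V := by simp [mul_comm]

open Classical in
lemma SimpleGraph.mul_diam_add_one_le {V : Type*} [Fintype V] (G : SimpleGraph V)
    [DecidableRel G.Adj] {k δ : ℕ} (hk : k = 3 ∨ k = 4) (hconn : G.Connected)
    (hcol : G.Colorable k) (hdeg : δ ≤ G.minDegree) :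
    (δ : ℝ) * (k * (G.diam + 1)) ≤ (3 * k - 2) * Fintype.card V := by
  have := hconn.nonempty
  obtain ⟨col⟩ := hcol
  obtain ⟨u, v, huv⟩ := G.exists_dist_eq_diam
  have htop := SimpleGraph.connected_iff_ediam_ne_top.1 hconn
  set S : ℤ → Finset (Fin k) := fun j =>
    Finset.univ.filter fun c => ∃ w, (G.dist u w : ℤ) = j ∧ col w = c with hSdef
  have hmem : ∀ w, col w ∈ S (G.dist u w) := fun w => by
    simp only [hSdef, Finset.mem_filter_univ]
    exact ⟨w, rfl, rfl⟩
  have hS : ∀ j, (S j).Nonempty ↔ j ∈ Finset.Icc (0 : ℤ) G.diam := by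
    intro j
    rw [Finset.mem_Icc]
    constructor
    · rintro ⟨c, hc⟩
      obtain ⟨w, rfl, -⟩ := (Finset.mem_filter_univ c).1 hc
      exact ⟨by positivity, by exact_mod_cast SimpleGraph.dist_le_diam htop⟩
    · rintro ⟨h0, hD⟩
      lift j to ℕ using h0
      obtain ⟨w, rfl⟩ := hconn.exists_dist_eq u v (i := j) (by rw [huv]; exact_mod_cast hD)
      exact ⟨_, hmem w⟩
  obtain ⟨y, hy0, hyS, hysum, hybd⟩ := exists_dual_weights hk G.diam hS
  have hrep : ∀ q : ℤ × Fin k, ∃ w, q.2 ∈ S q.1 → (G.dist u w : ℤ) = q.1 ∧ col w = q.2 := by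
    rintro ⟨j, c⟩
    by_cases hc : c ∈ S j
    · obtain ⟨w, hw⟩ := (Finset.mem_filter_univ c).1 hc
      exact ⟨w, fun _ => hw⟩
    · exact ⟨u, fun h => absurd h hc⟩
  choose r hr using hrep
  have main := G.mul_sum_le_mul_card hdeg (Finset.Icc (0 : ℤ) G.diam ×ˢ Finset.univ) r
    (fun q => y q.1 q.2) (fun q => hy0 _ _) (M := 3 * k - 2) ?_
  · rwa [Finset.sum_product, hysum] at main
  intro w
  refine le_trans ?_ (hybd _ _ (hmem w))
  rw [← Finset.sum_product' (f := y)]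
  rw [← Finset.sum_filter_ne_zero]
  refine Finset.sum_le_sum_of_subset_of_nonneg (fun q hq => ?_) fun q _ _ => hy0 _ _
  obtain ⟨hq, hne⟩ := Finset.mem_filter.1 hq
  have hqS : q.2 ∈ S q.1 := by
    by_contra h
    exact hne (hyS _ _ h)
  obtain ⟨h1, h2⟩ := hr q hqS
  have hadj := (Finset.mem_filter.1 hq).2
  have hne' := col.valid hadj
  have := hconn.dist_triangle (u := u) (v := w) (w := r q)
  have := hconn.dist_triangle (u := u) (v := r q) (w := w)
  rw [G.dist_comm (u := r q)] at this
  rw [SimpleGraph.dist_eq_one_iff_adj.2 hadj] at *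
  simp only [Finset.mem_product, Finset.mem_Icc, Finset.mem_erase, Finset.mem_univ, and_true]
  exact ⟨by omega, fun h => hne' (by rw [h2, h])⟩

theorem stmt_2 {V : Type*} [Fintype V] (G : SimpleGraph V) [DecidableRel G.Adj]
    (k n δ : ℕ) (hk : k = 3 ∨ k = 4) (hn : Fintype.card V = n) (hδ : 1 ≤ δ)
    (hconn : G.Connected) (hcol : G.Colorable k) (hdeg : δ ≤ G.minDegree) :
    (G.diam : ℝ) ≤ (3 - 2 / k) * (n / δ) - 1 := by
  have h := G.mul_diam_add_one_le hk hconn hcol hdeg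
  rw [hn] at h
  have hk0 : (0 : ℝ) < k := by exact_mod_cast (by omega : 0 < k)
  have hδ0 : (0 : ℝ) < δ := by exact_mod_cast hδ
  have e : (3 - 2 / (k : ℝ)) * (n / δ) = (3 * k - 2) * n / (δ * k) := by
    field_simp
  rw [le_sub_iff_add_le, e, le_div_iff₀ (by positivity)]
  linarith
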